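/- arXiv:2502.11243 — 3 statements merged into one kernel-verified Lean document; each statement's English description precedes it below -/
import Mathlib

section
/- Fix r ∈ ℝ, a nonconstant vector x ∈ ℝ^m, and ε > 0, and consider the two-player game G_{r,x,ε} in which player 1 chooses a pair (c,π) with c ∈ {a_x,a_r} and π a permutation of {1,…,m}, player 2 chooses a_2 ∈ {1,…,m}, and payoffs are u_1((a_x,π),a_2)=x_{π(a_2)}, u_1((a_r,π),a_2)=r+ε·x_{π(a_2)}, and u_2((c,π),a_2)=−x_{π(a_2)}. Then in every mixed strategy profile p of G_{r,x,ε} in which, for each player i, every action a_i with u_i(b_i,p_{-i}) >_FOSD u_i(a_i,p_{-i}) for some b_i ∈ A_i is played with probability zero (i.e., p is an FOSD-Nash), p_2 is the uniform distribution on {1,…,m}. -/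
open Filter Topology MeasureTheory

noncomputable section

namespace Paper

/-! ## Lotteries as finitely supported probability mass functions on ℝ -/

open Classical in
/-- The point mass at `a`. -/
def delta {α : Type*} (a : α) : α → ℝ := fun b => if b = a then 1 else 0

/-- `f` is (the p.m.f. of) a finitely supported lottery. -/
def IsFinLottery (f : ℝ → ℝ) : Prop :=
  (∀ x, 0 ≤ f x) ∧ (Function.support f).Finite ∧ ∑ᶠ x, f x = 1

/-- The CDF of a mass function. -/
def cdfOf (f : ℝ → ℝ) (t : ℝ) : ℝ := ∑ᶠ x, if x ≤ t then f x else 0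

/-- Convolution: the distribution of the sum of independent draws. -/
def conv (f g : ℝ → ℝ) : ℝ → ℝ := fun z => ∑ᶠ x, f x * g (z - x)

/-- Expectation of a finitely supported lottery. -/
def expOf (f : ℝ → ℝ) : ℝ := ∑ᶠ x, x * f x

/-- Weak first-order stochastic dominance of `f` over `g`. -/
def FOSDgeF (f g : ℝ → ℝ) : Prop := ∀ t, cdfOf f t ≤ cdfOf g t

/-- Strict first-order stochastic dominance of `f` over `g`. -/
def FOSDgtF (f g : ℝ → ℝ) : Prop := FOSDgeF f g ∧ f ≠ g

/-- Finitely supported lotteries with rational-valued CDF (`Δ_ℚ`). -/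
def IsDeltaQ (f : ℝ → ℝ) : Prop := IsFinLottery f ∧ ∀ t, ∃ q : ℚ, cdfOf f t = (q : ℝ)

/-- Monotone additive statistic on all finitely supported lotteries. -/
def MAS (Φ : (ℝ → ℝ) → ℝ) : Prop :=
  (∀ c : ℝ, Φ (delta c) = c) ∧
  (∀ f g, IsFinLottery f → IsFinLottery g → Φ (conv f g) = Φ f + Φ g) ∧
  (∀ f g, IsFinLottery f → IsFinLottery g → FOSDgeF f g → Φ g ≤ Φ f)

/-- Monotone additive statistic on `Δ_ℚ`. -/
def MASQ (Φ : (ℝ → ℝ) → ℝ) : Prop :=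
  (∀ c : ℝ, Φ (delta c) = c) ∧
  (∀ f g, IsDeltaQ f → IsDeltaQ g → Φ (conv f g) = Φ f + Φ g) ∧
  (∀ f g, IsDeltaQ f → IsDeltaQ g → FOSDgeF f g → Φ g ≤ Φ f)

/-- The statistic `K_a` for `a` in the extended real line. -/
def Kstat (a : EReal) (f : ℝ → ℝ) : ℝ :=
  if a = ⊤ then sSup (Function.support f)
  else if a = ⊥ then sInf (Function.support f)
  else if a = 0 then expOf f
  else (a.toReal)⁻¹ * Real.log (∑ᶠ x, Real.exp (a.toReal * x) * f x)

/-- `K_a` for real `a`. -/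
def Kreal (a : ℝ) : (ℝ → ℝ) → ℝ := Kstat (a : EReal)

/-- The statistic `Φ[X] = ∫ K_a[X] dμ(a)`. -/
def PhiInt (μ : Measure EReal) (f : ℝ → ℝ) : ℝ := ∫ a, Kstat a f ∂μ

/-! ## Finite normal-form games -/

structure Game (N : ℕ) where
  A : Fin N → Type
  fintypeA : ∀ i, Fintype (A i)
  nonemptyA : ∀ i, Nonempty (A i)
  u : ((i : Fin N) → A i) → Fin N → ℝ

instance {N : ℕ} (G : Game N) (i : Fin N) : Fintype (G.A i) := G.fintypeA i
instance {N : ℕ} (G : Game N) (i : Fin N) : Nonempty (G.A i) := G.nonemptyA i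

/-- A (mixed strategy) profile: a real-valued function on each action set. -/
abbrev Profile {N : ℕ} (G : Game N) := (i : Fin N) → G.A i → ℝ

/-- `p` is a mixed strategy profile. -/
def IsMixed {N : ℕ} (G : Game N) (p : Profile G) : Prop :=
  ∀ i, (∀ ai, 0 ≤ p i ai) ∧ ∑ ai, p i ai = 1

/-- Probability of the full action profile `a` under independent mixing `p`. -/
def weight {N : ℕ} (G : Game N) (p : Profile G) (a : (i : Fin N) → G.A i) : ℝ :=
  ∏ j, p j (a j)

/-- The p.m.f. of player `i`'s payoff lottery `u_i(a_i, p_{-i})`. -/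
def payMass {N : ℕ} (G : Game N) (p : Profile G) (i : Fin N) (ai : G.A i) : ℝ → ℝ :=
  fun t => ∑ a : (j : Fin N) → G.A j,
    if G.u a i = t then weight G (Function.update p i (delta ai)) a else 0

/-- Expected payoff `E[u_i(a_i, p_{-i})]`. -/
def expPay {N : ℕ} (G : Game N) (p : Profile G) (i : Fin N) (ai : G.A i) : ℝ :=
  ∑ a : (j : Fin N) → G.A j, weight G (Function.update p i (delta ai)) a * G.u a i

/-- Expected value of `f` applied to player `i`'s payoff lottery. -/
def expPayOf {N : ℕ} (G : Game N) (p : Profile G) (i : Fin N) (ai : G.A i) (f : ℝ → ℝ) : ℝ :=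
  ∑ a : (j : Fin N) → G.A j, weight G (Function.update p i (delta ai)) a * f (G.u a i)

/-- Minimum over `a_{-i}` of `u_i(a_i, a_{-i})`. -/
def minPay {N : ℕ} (G : Game N) (i : Fin N) (ai : G.A i) : ℝ :=
  ⨅ a : (j : Fin N) → G.A j, G.u (Function.update a i ai) i

/-- Maximum over `a_{-i}` of `u_i(a_i, a_{-i})`. -/
def maxPay {N : ℕ} (G : Game N) (i : Fin N) (ai : G.A i) : ℝ :=
  ⨆ a : (j : Fin N) → G.A j, G.u (Function.update a i ai) i

/-- `a_i` is strictly dominated (by some `b_i`). -/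
def StrictlyDominated {N : ℕ} (G : Game N) (i : Fin N) (ai : G.A i) : Prop :=
  ∃ bi : G.A i, ∀ a : (j : Fin N) → G.A j,
    G.u (Function.update a i ai) i < G.u (Function.update a i bi) i

/-! ## Solution concepts and axioms -/

abbrev SolCon (N : ℕ) := (G : Game N) → Set (Profile G)

/-- A solution concept assigns to each game a nonempty set of mixed strategy profiles. -/
def IsSolutionConcept {N : ℕ} (S : SolCon N) : Prop :=
  ∀ G, (S G).Nonempty ∧ ∀ p ∈ S G, IsMixed G p

/-- The composite game `G ⊗ H`. -/
def Game.comp {N : ℕ} (G H : Game N) : Game N where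
  A := fun i => G.A i × H.A i
  fintypeA := fun i => inferInstance
  nonemptyA := fun i => inferInstance
  u := fun c i => G.u (fun j => (c j).1) i + H.u (fun j => (c j).2) i

/-- The product profile `p × q`. -/
def prodProfile {N : ℕ} {G H : Game N} (p : Profile G) (q : Profile H) :
    Profile (G.comp H) := fun i ab => p i ab.1 * q i ab.2

def Bracketing {N : ℕ} (S : SolCon N) : Prop :=
  ∀ (G H : Game N) (p : Profile G) (q : Profile H),
    p ∈ S G → q ∈ S H → prodProfile p q ∈ S (G.comp H)

/-- The permuted game `G_π`. -/
def Game.permute {N : ℕ} (G : Game N) (π : Equiv.Perm (Fin N)) : Game N where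
  A := fun i => G.A (π i)
  fintypeA := fun i => G.fintypeA (π i)
  nonemptyA := fun i => G.nonemptyA (π i)
  u := fun b i =>
    G.u (fun j => cast (congrArg G.A (π.apply_symm_apply j)) (b (π.symm j))) (π i)

def Anonymity {N : ℕ} (S : SolCon N) : Prop :=
  ∀ (π : Equiv.Perm (Fin N)) (G : Game N) (p : Profile G),
    p ∈ S G → (fun i => p (π i)) ∈ S (G.permute π)

def ExpectationMonotone {N : ℕ} (S : SolCon N) : Prop :=
  ∀ G, ∀ p ∈ S G, ∀ i, ∀ ai bi : G.A i,
    expPay G p i bi < expPay G p i ai → p i bi ≤ p i ai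

def ExpectationNeutral {N : ℕ} (S : SolCon N) : Prop :=
  ∀ G, ∀ p ∈ S G, ∀ i, ∀ ai bi : G.A i,
    expPay G p i ai = expPay G p i bi → p i ai = p i bi

def DistributionMonotone {N : ℕ} (S : SolCon N) : Prop :=
  ∀ G, ∀ p ∈ S G, ∀ i, ∀ ai bi : G.A i,
    FOSDgtF (payMass G p i ai) (payMass G p i bi) → p i bi ≤ p i ai

def Interiority {N : ℕ} (S : SolCon N) : Prop :=
  ∀ G, ∀ p ∈ S G, ∀ i, ∀ ai : G.A i, 0 < p i ai

/-- The game with payoffs rescaled by `α`. -/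
def Game.scale {N : ℕ} (G : Game N) (α : ℝ) : Game N :=
  { G with u := fun a i => α * G.u a i }

def ScaleInvariant {N : ℕ} (S : SolCon N) : Prop :=
  ∀ G : Game N, ∀ p ∈ S G,
    (∀ i, ∀ ai : G.A i, p i ai = ((Fintype.card (G.A i) : ℝ))⁻¹) →
    ∀ α ∈ Set.Ioo (0 : ℝ) 1, p ∈ S (G.scale α)

def StratInvariant {N : ℕ} (S : SolCon N) : Prop :=
  ∀ (G : Game N) (u' : ((i : Fin N) → G.A i) → Fin N → ℝ),
    (∀ i, ∃ w : ((j : Fin N) → G.A j) → ℝ,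
      (∀ a, ∀ bi : G.A i, w (Function.update a i bi) = w a) ∧
      (∀ a, u' a i = G.u a i + w a)) →
    S G = S { G with u := u' }

/-! ## Equilibrium notions -/

def IsNash {N : ℕ} (G : Game N) (p : Profile G) : Prop :=
  ∀ i, ∀ ai : G.A i, 0 < p i ai → ∀ bi : G.A i, expPay G p i bi ≤ expPay G p i ai

def IsLQRE {N : ℕ} (lam : ℝ) (G : Game N) (p : Profile G) : Prop :=
  ∀ i, ∀ ai : G.A i,
    p i ai = Real.exp (lam * expPay G p i ai) / ∑ bi, Real.exp (lam * expPay G p i bi)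

def IsNashPhi {N : ℕ} (Φ : (ℝ → ℝ) → ℝ) (G : Game N) (p : Profile G) : Prop :=
  ∀ i, ∀ ai : G.A i, 0 < p i ai → ∀ bi : G.A i,
    Φ (payMass G p i bi) ≤ Φ (payMass G p i ai)

def IsLQREPhi {N : ℕ} (Φ : (ℝ → ℝ) → ℝ) (lam : ℝ) (G : Game N) (p : Profile G) : Prop :=
  ∀ i, ∀ ai : G.A i,
    p i ai = Real.exp (lam * Φ (payMass G p i ai)) /
      ∑ bi, Real.exp (lam * Φ (payMass G p i bi))

def IsFOSDNash {N : ℕ} (G : Game N) (p : Profile G) : Prop :=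
  ∀ i, ∀ ai : G.A i,
    (∃ bi : G.A i, FOSDgtF (payMass G p i bi) (payMass G p i ai)) → p i ai = 0

def IsFOSDQRE {N : ℕ} (G : Game N) (p : Profile G) : Prop :=
  (∀ i, ∀ ai : G.A i, 0 < p i ai) ∧
  ∀ i, ∀ ai bi : G.A i,
    FOSDgeF (payMass G p i ai) (payMass G p i bi) → p i bi ≤ p i ai

def IsMinMaxMean {N : ℕ} (l1 l2 l3 : ℝ) (G : Game N) (p : Profile G) : Prop :=
  ∀ i, ∀ ai : G.A i,
    p i ai = Real.exp (l1 * minPay G i ai + l2 * expPay G p i ai + l3 * maxPay G i ai) /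
      ∑ bi, Real.exp (l1 * minPay G i bi + l2 * expPay G p i bi + l3 * maxPay G i bi)

def CompatibleEU {N : ℕ} (S : SolCon N) : Prop :=
  ∃ f : ℝ → ℝ, StrictMono f ∧ Continuous f ∧
    ∀ G, ∀ p ∈ S G, ∀ i, ∀ ai bi : G.A i,
      expPayOf G p i bi f < expPayOf G p i ai f → p i bi ≤ p i ai

/-! ## Lotteries as compactly supported probability measures on ℝ -/

/-- Convolution of measures: distribution of the sum of independent draws. -/
def mconv (μ ν : Measure ℝ) : Measure ℝ := (μ.prod ν).map (fun z : ℝ × ℝ => z.1 + z.2)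

/-- `npow μ m` is the `m`-fold convolution `μ^m`. -/
def npow (μ : Measure ℝ) : ℕ → Measure ℝ
  | 0 => Measure.dirac 0
  | n + 1 => mconv (npow μ n) μ

/-- The distribution of `β` times a draw from `μ`. -/
def mscale (β : ℝ) (μ : Measure ℝ) : Measure ℝ := μ.map (fun x => β * x)

/-- `μ` is compactly supported. -/
def CompSupp (μ : Measure ℝ) : Prop := ∃ a b : ℝ, μ (Set.Icc a b)ᶜ = 0

/-- The minimum of the support of `μ`. -/
def minSupp (μ : Measure ℝ) : ℝ := sSup {x : ℝ | μ (Set.Iio x) = 0}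

/-- The maximum of the support of `μ`. -/
def maxSupp (μ : Measure ℝ) : ℝ := sInf {x : ℝ | μ (Set.Ioi x) = 0}

/-- Weak first-order stochastic dominance of `μ` over `ν`. -/
def FOSDgeM (μ ν : Measure ℝ) : Prop := ∀ t, μ (Set.Iic t) ≤ ν (Set.Iic t)

/-- Strict first-order stochastic dominance of `μ` over `ν`. -/
def FOSDgtM (μ ν : Measure ℝ) : Prop := FOSDgeM μ ν ∧ μ ≠ ν

/-- Monotone additive statistic on compactly supported lotteries (as measures). -/
def MASm (Φ : Measure ℝ → ℝ) : Prop :=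
  (∀ c : ℝ, Φ (Measure.dirac c) = c) ∧
  (∀ μ ν : Measure ℝ, IsProbabilityMeasure μ → IsProbabilityMeasure ν →
    CompSupp μ → CompSupp ν → Φ (mconv μ ν) = Φ μ + Φ ν) ∧
  (∀ μ ν : Measure ℝ, IsProbabilityMeasure μ → IsProbabilityMeasure ν →
    CompSupp μ → CompSupp ν → FOSDgeM μ ν → Φ ν ≤ Φ μ)

/-! ## Two-player games, unbundled -/

/-- `p` is a probability distribution on the finite type `α`. -/
def IsDist {α : Type*} [Fintype α] (p : α → ℝ) : Prop :=
  (∀ a, 0 ≤ p a) ∧ ∑ a, p a = 1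

/-- Payoff lottery of player 1 playing `a` against the mixed strategy `q`. -/
def mass1 {α β : Type*} [Fintype β] (u : α → β → ℝ) (q : β → ℝ) (a : α) : ℝ → ℝ :=
  fun t => ∑ b, if u a b = t then q b else 0

/-- Payoff lottery of player 2 playing `b` against the mixed strategy `p`. -/
def mass2 {α β : Type*} [Fintype α] (u : α → β → ℝ) (p : α → ℝ) (b : β) : ℝ → ℝ :=
  fun t => ∑ a, if u a b = t then p a else 0

/-- The distribution of a random variable on the uniform space `{1,…,m}`. -/
def distOf {m : ℕ} (X : Fin m → ℝ) : ℝ → ℝ :=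
  fun t => (∑ ω : Fin m, if X ω = t then (1 : ℝ) else 0) / m


/-- Player 1's payoffs in the game `G_{r,x,ε}`: player 1 picks `(c, π)` where
`c.1 = true` stands for `a_x` and `c.1 = false` for `a_r`, and `c.2 = π` is a
shuffling; player 2 picks a card `b`. -/
def u1G (m : ℕ) (r : ℝ) (x : Fin m → ℝ) (ε : ℝ) :
    Bool × Equiv.Perm (Fin m) → Fin m → ℝ :=
  fun c b => if c.1 then x (c.2 b) else r + ε * x (c.2 b)

/-- Player 2's payoffs in the game `G_{r,x,ε}`. -/
def u2G (m : ℕ) (x : Fin m → ℝ) : Bool × Equiv.Perm (Fin m) → Fin m → ℝ :=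
  fun c b => -(x (c.2 b))

/-- A test function integrates against a pushforward mass function by change of variables. -/
theorem finsum_mul_pushforward {ι : Type*} [Fintype ι] (v w : ι → ℝ) (φ : ℝ → ℝ) :
    ∑ᶠ t, φ t * (∑ i, if v i = t then w i else 0) = ∑ i, φ (v i) * w i := by
  simp_rw [Finset.mul_sum]
  have hsingle : ∀ i, ∀ t, t ≠ v i → φ t * (if v i = t then w i else 0) = 0 := by
    intro i t ht
    rw [if_neg ht.symm, mul_zero]
  rw [finsum_sum_comm]
  · refine Finset.sum_congr rfl fun i _ => ?_
    rw [finsum_eq_single _ (v i) (hsingle i), if_pos rfl]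
  · intro i _
    refine (Set.finite_singleton (v i)).subset fun t ht => ?_
    by_contra h
    exact ht (hsingle i t h)

/-- Two pushforward mass functions with ordered CDFs and distinct means are strictly ordered. -/
theorem fosdgt_of_cdf_le_of_mean_ne {ι : Type*} [Fintype ι] {v v' w w' : ι → ℝ}
    (hle : ∀ t, ∑ i, (if v' i ≤ t then 1 else 0) * w' i ≤
      ∑ i, (if v i ≤ t then 1 else 0) * w i)
    (hne : ∑ i, v' i * w' i ≠ ∑ i, v i * w i) :
    FOSDgtF (fun t => ∑ i, if v' i = t then w' i else 0)
      (fun t => ∑ i, if v i = t then w i else 0) := by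
  refine ⟨fun t => ?_, fun h => hne ?_⟩
  · have key : ∀ v w : ι → ℝ, cdfOf (fun t => ∑ i, if v i = t then w i else 0) t =
        ∑ i, (if v i ≤ t then 1 else 0) * w i := by
      intro v w
      rw [← finsum_mul_pushforward v w (fun s => if s ≤ t then 1 else 0)]
      simp only [cdfOf, ite_mul, one_mul, zero_mul]
    rw [key, key]
    exact hle t
  · exact (finsum_mul_pushforward v' w' id).symm.trans
      ((congrArg (fun f : ℝ → ℝ => ∑ᶠ t, id t * f t) h).trans (finsum_mul_pushforward v w id))

/-- The effect of a transposition on a weighted sum. -/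
theorem sum_comp_swap_sub {ι : Type*} [Fintype ι] [DecidableEq ι] {a b : ι} (hab : a ≠ b)
    (F w : ι → ℝ) :
    ∑ i, F (Equiv.swap a b i) * w i - ∑ i, F i * w i = (F a - F b) * (w b - w a) := by
  rw [← Finset.sum_sub_distrib, Fintype.sum_eq_add a b hab]
  · rw [Equiv.swap_apply_left, Equiv.swap_apply_right]
    ring
  · rintro i ⟨ha, hb⟩
    rw [Equiv.swap_apply_of_ne_of_ne ha hb, sub_self]

/-- Moving the higher payoff onto the likelier state strictly improves a lottery. -/
theorem fosdgt_comp_swap {ι : Type*} [Fintype ι] [DecidableEq ι] {v w : ι → ℝ} {a b : ι}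
    (hv : v b < v a) (hw : w a < w b) :
    FOSDgtF (fun t => ∑ i, if v (Equiv.swap a b i) = t then w i else 0)
      (fun t => ∑ i, if v i = t then w i else 0) := by
  have hab : a ≠ b := by
    rintro rfl
    exact lt_irrefl _ hv
  refine fosdgt_of_cdf_le_of_mean_ne (fun t => ?_) fun h => ?_
  · have h := sum_comp_swap_sub hab (fun i => if v i ≤ t then (1 : ℝ) else 0) w
    have h' : (if v a ≤ t then (1 : ℝ) else 0) ≤ if v b ≤ t then 1 else 0 := by
      split_ifs <;> linarith
    have := mul_nonpos_of_nonpos_of_nonneg (sub_nonpos.2 h') (sub_nonneg.2 hw.le)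
    linarith
  · have := sum_comp_swap_sub hab v w
    have := mul_pos (sub_pos.2 hv) (sub_pos.2 hw)
    linarith

/-- Raising payoffs pointwise on the support, strictly somewhere, strictly improves a lottery. -/
theorem fosdgt_of_le_of_lt {ι : Type*} [Fintype ι] {v v' w : ι → ℝ} (hw : ∀ i, 0 ≤ w i)
    (hle : ∀ i, 0 < w i → v i ≤ v' i) {j : ι} (hj : 0 < w j) (hlt : v j < v' j) :
    FOSDgtF (fun t => ∑ i, if v' i = t then w i else 0)
      (fun t => ∑ i, if v i = t then w i else 0) := by
  refine fosdgt_of_cdf_le_of_mean_ne (fun t => Finset.sum_le_sum fun i _ => ?_)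
    (Finset.sum_lt_sum (fun i _ => ?_) ⟨j, Finset.mem_univ j, ?_⟩).ne'
  · rcases (hw i).eq_or_lt with h | h
    · simp [← h]
    · refine mul_le_mul_of_nonneg_right ?_ (hw i)
      have := hle i h
      split_ifs <;> linarith
  · rcases (hw i).eq_or_lt with h | h
    · simp [← h]
    · exact mul_le_mul_of_nonneg_right (hle i h) (hw i)
  · exact mul_lt_mul_of_pos_right hlt hj

/-- For a fixed choice, player 1's payoff is strictly increasing in the value of the card. -/
theorem u1G_lt_of_lt {m : ℕ} {r : ℝ} {x : Fin m → ℝ} {ε : ℝ} (hε : 0 < ε)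
    (c : Bool × Equiv.Perm (Fin m)) {a b : Fin m} (h : x (c.2 b) < x (c.2 a)) :
    u1G m r x ε c b < u1G m r x ε c a := by
  have := mul_lt_mul_of_pos_left h hε
  unfold u1G
  split_ifs <;> linarith

/-- in every FOSD-Nash of the game `G_{r,x,ε}` (with `x` nonconstant and
`ε > 0`), player 2 mixes uniformly. -/
theorem stmt16 (m : ℕ) (hm : 0 < m) (r : ℝ) (x : Fin m → ℝ)
    (hx : ∃ j k, x j ≠ x k) (ε : ℝ) (hε : 0 < ε)
    (p1 : Bool × Equiv.Perm (Fin m) → ℝ) (p2 : Fin m → ℝ)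
    (hp1 : IsDist p1) (hp2 : IsDist p2)
    (hN1 : ∀ c : Bool × Equiv.Perm (Fin m),
      (∃ c' : Bool × Equiv.Perm (Fin m),
        FOSDgtF (mass1 (u1G m r x ε) p2 c') (mass1 (u1G m r x ε) p2 c)) → p1 c = 0)
    (hN2 : ∀ b : Fin m,
      (∃ b' : Fin m,
        FOSDgtF (mass2 (u2G m x) p1 b') (mass2 (u2G m x) p1 b)) → p2 b = 0) :
    ∀ b, p2 b = (m : ℝ)⁻¹ := by
  have order : ∀ c, 0 < p1 c → ∀ a b, p2 a < p2 b → x (c.2 a) ≤ x (c.2 b) := by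
    intro c hc a b hab
    by_contra! h
    exact hc.ne' (hN1 c ⟨(c.1, (Equiv.swap a b).trans c.2),
      fosdgt_comp_swap (u1G_lt_of_lt hε c h) hab⟩)
  have tie : ∀ c, 0 < p1 c → ∀ a b, p2 a < p2 b → x (c.2 a) = x (c.2 b) := by
    intro c hc a b hab
    refine (order c hc a b hab).antisymm (le_of_not_gt fun h => ?_)
    exact ((hp2.1 a).trans_lt hab).ne' (hN2 b ⟨a, fosdgt_of_le_of_lt hp1.1
      (fun c' hc' => neg_le_neg (order c' hc' a b hab)) hc (neg_lt_neg h)⟩)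
  obtain ⟨c, hc⟩ : ∃ c, 0 < p1 c := by
    by_contra! h
    linarith [hp1.2, Finset.sum_nonpos fun c (_ : c ∈ Finset.univ) => h c]
  have tie' : ∀ a b, p2 a ≠ p2 b → x (c.2 a) = x (c.2 b) := fun a b h =>
    h.lt_or_gt.elim (tie c hc a b) fun h => (tie c hc b a h).symm
  have const : ∀ a b, p2 a = p2 b := by
    intro a b
    by_contra hab
    have all : ∀ k, x (c.2 k) = x (c.2 a) := by
      intro k
      by_cases hk : p2 k = p2 a
      · exact (tie' k b (hk ▸ hab)).trans (tie' a b hab).symm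
      · exact tie' k a hk
    obtain ⟨j, k, hjk⟩ := hx
    apply hjk
    simpa using (all (c.2.symm j)).trans (all (c.2.symm k)).symm
  intro b
  have hsum := hp2.2
  rw [Finset.sum_congr rfl fun a _ => const a b, Finset.sum_const, Finset.card_univ,
    Fintype.card_fin, nsmul_eq_mul] at hsum
  exact eq_inv_of_mul_eq_one_right hsum

end Paper
end
end

section
/- Let Φ : Δ_ℚ → ℝ be a monotone additive statistic on Δ_ℚ, and let X be a lottery with finite support. Then the sequences (Φ[ubar X_n])_n and (Φ[bar X_n])_n both converge and have the same limit, i.e., lim_n Φ[ubar X_n] = lim_n Φ[bar X_n]. -/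
open Filter Topology MeasureTheory

noncomputable section

namespace Paper

/-- The equal-weight mixture of the translates of `f` by `s 0, …, s (K - 1)`. -/
def shiftMix (f : ℝ → ℝ) (s : ℕ → ℝ) (K : ℕ) : ℝ → ℝ :=
  fun z => ∑ k ∈ Finset.range K, (K : ℝ)⁻¹ * f (z - s k)

lemma finite_support_comp_sub {f : ℝ → ℝ} (hf : (Function.support f).Finite) (c : ℝ) :
    (Function.support fun z => f (z - c)).Finite := by
  refine (hf.image (fun x => x + c)).subset ?_
  intro z hz
  exact ⟨z - c, hz, by ring⟩

lemma finsum_comp_sub (f : ℝ → ℝ) (c : ℝ) : ∑ᶠ z, f (z - c) = ∑ᶠ z, f z :=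
  finsum_comp_equiv (Equiv.subRight c)

lemma finite_support_ite {f : ℝ → ℝ} (hf : (Function.support f).Finite) (P : ℝ → Prop)
    [DecidablePred P] : (Function.support fun x => if P x then f x else 0).Finite := by
  refine hf.subset fun x hx h => hx ?_
  simp [h]

lemma finite_support_shiftMix {f : ℝ → ℝ} (hf : (Function.support f).Finite) (s : ℕ → ℝ)
    (K : ℕ) : (Function.support (shiftMix f s K)).Finite := by
  refine ((Finset.range K).finite_toSet.biUnion
    fun k _ => finite_support_comp_sub hf (s k)).subset ?_
  intro z hz
  obtain ⟨k, hk, hne⟩ := Finset.exists_ne_zero_of_sum_ne_zero hz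
  exact Set.mem_biUnion (Finset.mem_coe.2 hk) (right_ne_zero_of_mul hne)

lemma finsum_shiftMix {f : ℝ → ℝ} (hf : (Function.support f).Finite) (s : ℕ → ℝ) {K : ℕ}
    (hK : K ≠ 0) : ∑ᶠ z, shiftMix f s K z = ∑ᶠ z, f z := by
  unfold shiftMix
  rw [finsum_sum_comm]
  · simp [← mul_finsum' _ _ (finite_support_comp_sub hf _), finsum_comp_sub, hK]
  · intro k _
    refine (finite_support_comp_sub hf (s k)).subset fun z hz => right_ne_zero_of_mul hz

lemma cdfOf_shiftMix {f : ℝ → ℝ} (hf : (Function.support f).Finite) (s : ℕ → ℝ) (K : ℕ)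
    (t : ℝ) : cdfOf (shiftMix f s K) t =
      ∑ k ∈ Finset.range K, (K : ℝ)⁻¹ * cdfOf f (t - s k) := by
  have hfin : ∀ k, (Function.support fun x : ℝ => if x ≤ t then f (x - s k) else 0).Finite :=
    fun k => finite_support_ite (finite_support_comp_sub hf (s k)) _
  have h1 : ∀ x, (if x ≤ t then shiftMix f s K x else 0) =
      ∑ k ∈ Finset.range K, (K : ℝ)⁻¹ * (if x ≤ t then f (x - s k) else 0) := by
    intro x
    by_cases hx : x ≤ t <;> simp [hx, shiftMix]
  unfold cdfOf
  rw [finsum_congr h1, finsum_sum_comm]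
  · refine Finset.sum_congr rfl fun k _ => ?_
    rw [← mul_finsum' _ _ (hfin k), ← finsum_comp_sub
      (fun y => if y ≤ t - s k then f y else 0) (s k)]
    simp
  · intro k _
    exact (hfin k).subset fun z hz => right_ne_zero_of_mul hz

lemma IsFinLottery.shiftMix {f : ℝ → ℝ} (hf : IsFinLottery f) (s : ℕ → ℝ) {K : ℕ}
    (hK : K ≠ 0) : IsFinLottery (shiftMix f s K) := by
  refine ⟨fun z => Finset.sum_nonneg fun k _ => mul_nonneg (by positivity) (hf.1 _),
    finite_support_shiftMix hf.2.1 s K, ?_⟩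
  rw [finsum_shiftMix hf.2.1 s hK, hf.2.2]

lemma IsDeltaQ.shiftMix {f : ℝ → ℝ} (hf : IsDeltaQ f) (s : ℕ → ℝ) {K : ℕ}
    (hK : K ≠ 0) : IsDeltaQ (shiftMix f s K) := by
  refine ⟨hf.1.shiftMix s hK, fun t => ?_⟩
  choose q hq using hf.2
  refine ⟨∑ k ∈ Finset.range K, (K : ℚ)⁻¹ * q (t - s k), ?_⟩
  rw [cdfOf_shiftMix hf.1.2.1]
  simp [hq]

lemma isDeltaQ_delta (c : ℝ) : IsDeltaQ (delta c) := by
  refine ⟨⟨fun x => ?_, ?_, ?_⟩, fun t => ⟨if c ≤ t then 1 else 0, ?_⟩⟩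
  · unfold delta
    split_ifs <;> norm_num
  · refine (Set.finite_singleton c).subset fun x hx => ?_
    by_contra h
    exact hx (if_neg h)
  · rw [finsum_eq_single (delta c) c fun x hx => if_neg hx]
    exact if_pos rfl
  · unfold cdfOf
    rw [finsum_eq_single _ c fun x hx => by simp [delta, hx]]
    by_cases h : c ≤ t <;> simp [delta, h]

lemma conv_shiftMix_delta (f : ℝ → ℝ) (s : ℕ → ℝ) (K : ℕ) :
    conv f (shiftMix (delta 0) s K) = shiftMix f s K := by
  funext z
  have hz : ∀ k x, x ≠ z - s k → (delta 0 (z - x - s k) : ℝ) = 0 := fun k x hx =>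
    if_neg fun h => hx (by linarith)
  simp only [conv, shiftMix, Finset.mul_sum]
  rw [finsum_sum_comm]
  · refine Finset.sum_congr rfl fun k _ => ?_
    rw [finsum_eq_single _ (z - s k) fun x hx => by simp [hz k x hx]]
    simp [delta, mul_comm]
  · intro k _
    refine (Set.finite_singleton (z - s k)).subset fun x hx => ?_
    by_contra h
    exact hx (by simp [hz k x h])

lemma shiftMix_delta_one (c : ℝ) : shiftMix (delta 0) (fun _ => c) 1 = delta c := by
  funext z
  simp [shiftMix, delta, sub_eq_zero]

/-- Smoothing both lotteries with the same uniform grid of mesh `ε`: if the telescoped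
cumulative distribution functions compare, then `Φ g ≤ Φ f + ε`. -/
lemma MASQ.le_add_of_sum_cdfOf_le {Φ : (ℝ → ℝ) → ℝ} (hΦ : MASQ Φ) {f g : ℝ → ℝ}
    (hf : IsDeltaQ f) (hg : IsDeltaQ g) (ε : ℝ) {K : ℕ} (hK : K ≠ 0)
    (h : ∀ t, ∑ k ∈ Finset.range K, cdfOf f (t - (k + 1 : ℕ) * ε) ≤
      ∑ k ∈ Finset.range K, cdfOf g (t - k * ε)) : Φ g ≤ Φ f + ε := by
  set s : ℕ → ℝ := fun k => k * ε
  have hZ := (isDeltaQ_delta 0).shiftMix s hK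
  have hfs := hf.shiftMix s hK
  have hg' := hΦ.2.1 g _ hg hZ
  have hf' := hΦ.2.1 f _ hf hZ
  have hε := hΦ.2.1 _ _ hfs (isDeltaQ_delta ε)
  rw [← shiftMix_delta_one, conv_shiftMix_delta, shiftMix_delta_one, hΦ.1] at hε
  rw [conv_shiftMix_delta] at hf' hg'
  have hle := hΦ.2.2 _ _ (hfs.shiftMix (fun _ => ε) one_ne_zero) (hg.shiftMix s hK) (by
    intro t
    rw [cdfOf_shiftMix hfs.1.2.1, cdfOf_shiftMix hg.1.2.1]
    simp only [Finset.range_one, Finset.sum_singleton, Nat.cast_one, inv_one, one_mul]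
    rw [cdfOf_shiftMix hf.1.2.1, ← Finset.mul_sum, ← Finset.mul_sum]
    refine mul_le_mul_of_nonneg_left (le_of_eq_of_le ?_ (h t)) (by positivity)
    refine Finset.sum_congr rfl fun k _ => ?_
    congr 1
    simp only [s]
    push_cast
    ring)
  linarith

lemma cdfOf_nonneg {f : ℝ → ℝ} (hf : IsFinLottery f) (t : ℝ) : 0 ≤ cdfOf f t :=
  finsum_nonneg fun x => by split_ifs; exacts [hf.1 x, le_rfl]

lemma cdfOf_le_one {f : ℝ → ℝ} (hf : IsFinLottery f) (t : ℝ) : cdfOf f t ≤ 1 := by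
  rw [← hf.2.2]
  refine finsum_le_finsum' (finite_support_ite hf.2.1 _) hf.2.1 fun x => ?_
  split_ifs
  exacts [le_rfl, hf.1 x]

lemma le_cdfOf {f : ℝ → ℝ} (hf : IsFinLottery f) {a t : ℝ} (h : a ≤ t) :
    f a ≤ cdfOf f t := by
  have := single_le_finsum a (finite_support_ite hf.2.1 (· ≤ t))
    (fun x => by split_ifs; exacts [hf.1 x, le_rfl])
  rw [if_pos h] at this
  exact this

lemma cdfOf_add_le_one {f : ℝ → ℝ} (hf : IsFinLottery f) {b t : ℝ} (h : t < b) :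
    cdfOf f t + f b ≤ 1 := by
  have hfin : (Function.support fun x : ℝ => if ¬ x ≤ t then f x else 0).Finite :=
    finite_support_ite hf.2.1 _
  have h1 := single_le_finsum b hfin (fun x => by split_ifs; exacts [le_rfl, hf.1 x])
  have h2 := finsum_add_distrib (finite_support_ite hf.2.1 (· ≤ t)) hfin
  have h3 : ∀ x, (if x ≤ t then f x else 0) + (if ¬ x ≤ t then f x else 0) = f x := by
    intro x
    split_ifs <;> simp
  rw [finsum_congr h3, hf.2.2] at h2
  simp only [h.not_ge, not_false_eq_true, if_true] at h1
  unfold cdfOf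
  linarith

lemma cdfOf_eq_zero {f : ℝ → ℝ} {t : ℝ} (h : ∀ x, f x ≠ 0 → t < x) : cdfOf f t = 0 := by
  refine (finsum_congr fun x => ?_).trans finsum_zero
  by_cases hx : x ≤ t
  · rw [if_pos hx]
    by_contra h0
    exact (h x h0).not_ge hx
  · rw [if_neg hx]

lemma cdfOf_eq_one {f : ℝ → ℝ} (hf : IsFinLottery f) {t : ℝ} (h : ∀ x, f x ≠ 0 → x ≤ t) :
    cdfOf f t = 1 := by
  rw [← hf.2.2]
  refine finsum_congr fun x => ?_
  by_cases hx : f x = 0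
  · simp [hx]
  · rw [if_pos (h x hx)]

/-- A finitely supported lottery has a smallest and a largest atom. -/
lemma IsFinLottery.exists_atoms {f : ℝ → ℝ} (hf : IsFinLottery f) :
    ∃ a b p : ℝ, 0 < p ∧ (∀ t < a, cdfOf f t = 0) ∧ (∀ t, a ≤ t → p ≤ cdfOf f t) ∧
      (∀ t < b, cdfOf f t ≤ 1 - p) ∧ ∀ t, b ≤ t → cdfOf f t = 1 := by
  have hne : (Function.support f).Nonempty := by
    rw [Function.support_nonempty_iff]
    rintro rfl
    simpa using hf.2.2
  obtain ⟨a, ha, hmin⟩ := Set.exists_min_image _ id hf.2.1 hne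
  obtain ⟨b, hb, hmax⟩ := Set.exists_max_image _ id hf.2.1 hne
  refine ⟨a, b, min (f a) (f b), lt_min ((hf.1 a).lt_of_ne' ha) ((hf.1 b).lt_of_ne' hb),
    fun t ht => cdfOf_eq_zero fun x hx => ht.trans_le (hmin x hx),
    fun t ht => (min_le_left _ _).trans (le_cdfOf hf ht), fun t ht => ?_,
    fun t ht => cdfOf_eq_one hf fun x hx => (hmax x hx).trans ht⟩
  have := cdfOf_add_le_one hf ht
  have := min_le_right (f a) (f b)
  linarith

/-- If `f` and `g` are uniformly close to `h` in distribution, with the same extreme values as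
`h`, then their smoothings by a grid of mesh `ε` are ordered up to a shift by `ε`. -/
lemma sum_cdfOf_le {f g h : ℝ → ℝ} (hf : IsFinLottery f) (hg : IsFinLottery g)
    {a b p ε d : ℝ} (hε : 0 ≤ ε) (ha : ∀ t, a ≤ t → p ≤ cdfOf h t)
    (hb : ∀ t < b, cdfOf h t ≤ 1 - p) (hf0 : ∀ t < a, cdfOf f t = 0)
    (hg1 : ∀ t, b ≤ t → cdfOf g t = 1)
    (hfh : ∀ t, cdfOf f t ≤ cdfOf h t + d) (hgh : ∀ t, cdfOf h t - d ≤ cdfOf g t)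
    (hfg : ∀ t, cdfOf f t ≤ cdfOf g t + d) {K : ℕ} (hK : b - a < K * ε)
    (hd : K * d ≤ p) (t : ℝ) :
    ∑ k ∈ Finset.range K, cdfOf f (t - (k + 1 : ℕ) * ε) ≤
      ∑ k ∈ Finset.range K, cdfOf g (t - k * ε) := by
  rcases lt_or_ge t a with hta | hta
  · rw [Finset.sum_eq_zero fun k _ => hf0 _ ?_]
    · exact Finset.sum_nonneg fun k _ => cdfOf_nonneg hg _
    · have : 0 ≤ ((k + 1 : ℕ) : ℝ) * ε := by positivity
      linarith
  rcases le_or_gt b (t - K * ε) with htb | htb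
  · refine Finset.sum_le_sum fun k hk => ?_
    rw [hg1]
    · exact cdfOf_le_one hf _
    · have hkK : (k : ℝ) ≤ K := by exact_mod_cast (Finset.mem_range.1 hk).le
      have := mul_le_mul_of_nonneg_right hkK hε
      linarith
  have hend : cdfOf f (t - K * ε) + p - d ≤ cdfOf g t := by
    rcases lt_or_ge (t - K * ε) a with h1 | h1
    · rw [hf0 _ h1]
      linarith [ha t hta, hgh t]
    · rw [hg1 t (by linarith)]
      linarith [hb _ htb, hfh (t - K * ε)]
  cases K with
  | zero => simp
  | succ m =>
    rw [Finset.sum_range_succ, Finset.sum_range_succ']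
    have hsum : ∑ k ∈ Finset.range m, cdfOf f (t - (k + 1 : ℕ) * ε) ≤
        ∑ k ∈ Finset.range m, (cdfOf g (t - (k + 1 : ℕ) * ε) + d) :=
      Finset.sum_le_sum fun k _ => hfg _
    rw [Finset.sum_add_distrib] at hsum
    simp only [Finset.sum_const, Finset.card_range, nsmul_eq_mul] at hsum
    push_cast at hd hend hsum ⊢
    rw [zero_mul, sub_zero]
    linarith

lemma ceil_div_factorial_antitone (x : ℝ) :
    Antitone fun n : ℕ => ((⌈(n.factorial : ℝ) * x⌉ : ℤ) : ℝ) / (n.factorial : ℝ) := by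
  refine antitone_nat_of_succ_le fun n => ?_
  have hn : (0 : ℝ) < n.factorial := by positivity
  have hn1 : (0 : ℝ) < (n + 1).factorial := by positivity
  rw [div_le_div_iff₀ hn1 hn]
  have h : (⌈((n + 1).factorial : ℝ) * x⌉ : ℤ) ≤ (n + 1 : ℤ) * ⌈(n.factorial : ℝ) * x⌉ := by
    rw [Int.ceil_le, Nat.factorial_succ]
    push_cast
    rw [mul_assoc]
    exact mul_le_mul_of_nonneg_left (Int.le_ceil _) (by positivity)
  have h' : ((⌈((n + 1).factorial : ℝ) * x⌉ : ℤ) : ℝ) ≤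
      (n + 1 : ℝ) * ((⌈(n.factorial : ℝ) * x⌉ : ℤ) : ℝ) := by exact_mod_cast h
  calc _ ≤ (n + 1 : ℝ) * ((⌈(n.factorial : ℝ) * x⌉ : ℤ) : ℝ) * n.factorial :=
        mul_le_mul_of_nonneg_right h' hn.le
    _ = _ := by
        rw [Nat.factorial_succ]
        push_cast
        ring

lemma exists_rat_intCast_div_natCast (z : ℤ) (n : ℕ) : ∃ q : ℚ, (z : ℝ) / (n : ℝ) = q :=
  ⟨z / n, by push_cast; rfl⟩

/-- for a monotone additive statistic `Φ` on `Δ_ℚ` and a finitely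
supported lottery `f`, the sequences `Φ[ubar X_n]` and `Φ[bar X_n]` converge to
a common limit, where `ubar X_n` has CDF `⌈n!·F(t)⌉/n!` and `bar X_n` has CDF
`⌊n!·F(t)⌋/n!`. -/
theorem stmt17 (Φ : (ℝ → ℝ) → ℝ) (hΦ : MASQ Φ) (f : ℝ → ℝ) (hf : IsFinLottery f)
    (L U : ℕ → ℝ → ℝ)
    (hL : ∀ n : ℕ, IsFinLottery (L n) ∧ ∀ t,
      cdfOf (L n) t = ((⌈(n.factorial : ℝ) * cdfOf f t⌉ : ℤ) : ℝ) / (n.factorial : ℝ))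
    (hU : ∀ n : ℕ, IsFinLottery (U n) ∧ ∀ t,
      cdfOf (U n) t = ((⌊(n.factorial : ℝ) * cdfOf f t⌋ : ℤ) : ℝ) / (n.factorial : ℝ)) :
    ∃ l : ℝ, Tendsto (fun n => Φ (L n)) atTop (𝓝 l) ∧
      Tendsto (fun n => Φ (U n)) atTop (𝓝 l) := by
  have hfac : ∀ n : ℕ, (0 : ℝ) < n.factorial := fun n => by positivity
  have hLQ : ∀ n, IsDeltaQ (L n) := fun n =>
    ⟨(hL n).1, fun t => (hL n).2 t ▸ exists_rat_intCast_div_natCast _ _⟩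
  have hUQ : ∀ n, IsDeltaQ (U n) := fun n =>
    ⟨(hU n).1, fun t => (hU n).2 t ▸ exists_rat_intCast_div_natCast _ _⟩
  have hfL : ∀ n t, cdfOf f t ≤ cdfOf (L n) t := fun n t => by
    rw [(hL n).2, le_div_iff₀ (hfac n), mul_comm]
    exact Int.le_ceil _
  have hUf : ∀ n t, cdfOf (U n) t ≤ cdfOf f t := fun n t => by
    rw [(hU n).2, div_le_iff₀ (hfac n), mul_comm (cdfOf f t)]
    exact Int.floor_le _
  have hLf : ∀ n t, cdfOf (L n) t ≤ cdfOf f t + (n.factorial : ℝ)⁻¹ := fun n t => by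
    rw [(hL n).2, div_le_iff₀ (hfac n), add_mul, inv_mul_cancel₀ (hfac n).ne',
      mul_comm (cdfOf f t)]
    exact (Int.ceil_lt_add_one _).le
  have hfU : ∀ n t, cdfOf f t - (n.factorial : ℝ)⁻¹ ≤ cdfOf (U n) t := fun n t => by
    rw [(hU n).2, le_div_iff₀ (hfac n), sub_mul, inv_mul_cancel₀ (hfac n).ne',
      mul_comm (cdfOf f t)]
    exact (Int.sub_one_lt_floor _).le
  have hLU : ∀ n t, cdfOf (L n) t ≤ cdfOf (U n) t + (n.factorial : ℝ)⁻¹ := fun n t => by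
    rw [(hU n).2, (hL n).2, inv_eq_one_div, ← add_div, div_le_div_iff_of_pos_right (hfac n)]
    exact_mod_cast Int.ceil_le_floor_add_one _
  have hle : ∀ m n, Φ (L m) ≤ Φ (U n) := fun m n =>
    hΦ.2.2 _ _ (hUQ n) (hLQ m) fun t => (hUf n t).trans (hfL m t)
  have hmono : Monotone fun n => Φ (L n) := fun m n hmn =>
    hΦ.2.2 _ _ (hLQ n) (hLQ m) fun t => by
      rw [(hL n).2, (hL m).2]
      exact ceil_div_factorial_antitone _ hmn
  have hlim := tendsto_atTop_ciSup hmono ⟨Φ (U 0), by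
    rintro _ ⟨n, rfl⟩
    exact hle n 0⟩
  refine ⟨_, hlim, ?_⟩
  suffices hgap : Tendsto (fun n => Φ (U n) - Φ (L n)) atTop (𝓝 0) by
    simpa using hgap.add hlim
  obtain ⟨a, b, p, hp, ha0, ha, hb, hb1⟩ := hf.exists_atoms
  rw [Metric.tendsto_atTop]
  intro r hr
  obtain ⟨K, hK⟩ := exists_nat_gt (max 0 ((b - a) / (r / 2)))
  have hK0 : K ≠ 0 := by
    rintro rfl
    simp at hK
  have hKr : b - a < K * (r / 2) := (div_lt_iff₀ (half_pos hr)).1 ((le_max_right _ _).trans_lt hK)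
  obtain ⟨N, hN⟩ := exists_nat_gt (K / p)
  refine ⟨N, fun n hn => ?_⟩
  have hd : (K : ℝ) * (n.factorial : ℝ)⁻¹ ≤ p := by
    rw [← div_eq_mul_inv, div_le_iff₀ (hfac n), mul_comm, ← div_le_iff₀ hp]
    exact hN.le.trans (by exact_mod_cast hn.trans n.self_le_factorial)
  have hlast := hΦ.le_add_of_sum_cdfOf_le (hLQ n) (hUQ n) (r / 2) hK0
    (sum_cdfOf_le (hL n).1 (hU n).1 (half_pos hr).le ha hb
      (fun t ht => by simp [(hL n).2, ha0 t ht])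
      (fun t ht => by simp [(hU n).2, hb1 t ht, (hfac n).ne'])
      (hLf n) (hfU n) (hLU n) hKr hd)
  rw [Real.dist_eq, sub_zero, abs_of_nonneg (sub_nonneg.2 (hle n n))]
  linarith

end Paper
end
end

section
/- Let Φ : Δ_ℚ → ℝ be a map such that Φ[c]=c for every deterministic lottery c, Φ[Z] ≤ Φ[W] whenever Z,W ∈ Δ_ℚ and W first-order stochastically dominates Z, and such that Φ is additive for all (not necessarily independent) random variables: for every m ∈ ℕ and all random variables X, Y : {1,…,m} → ℝ on the uniform probability space {1,…,m}, Φ[dist(X+Y)] = Φ[dist(X)] + Φ[dist(Y)], where dist denotes the distribution under the uniform measure and X+Y is the pointwise sum. Then Φ is the expectation: Φ[X] = E[X] for every X ∈ Δ_ℚ. -/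
open Filter Topology MeasureTheory

noncomputable section

namespace Paper

lemma distOf_comp_equiv {m : ℕ} (X : Fin m → ℝ) (e : Fin m ≃ Fin m) :
    distOf (fun ω => X (e ω)) = distOf X := by
  funext t
  simp only [distOf]
  rw [Equiv.sum_comp e (fun ω => if X ω = t then (1 : ℝ) else 0)]

lemma distOf_const {m : ℕ} (hm : 0 < m) (c : ℝ) :
    distOf (fun _ : Fin m => c) = delta c := by
  have hm' : (m : ℝ) ≠ 0 := by positivity
  funext t
  by_cases h : c = t
  · simp [distOf, delta, h, hm']
  · simp [distOf, delta, h, Ne.symm h]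

/-- Averaging over all cyclic shifts turns a random variable into a constant, so a normalized
additive statistic must be the mean. -/
lemma additive_distOf (Φ : (ℝ → ℝ) → ℝ) (hconst : ∀ c : ℝ, Φ (delta c) = c) {m : ℕ} (hm : 0 < m)
    (hadd : ∀ X Y : Fin m → ℝ,
      Φ (distOf (fun ω => X ω + Y ω)) = Φ (distOf X) + Φ (distOf Y))
    (X : Fin m → ℝ) : (m : ℝ) * Φ (distOf X) = ∑ ω, X ω := by
  have : NeZero m := ⟨hm.ne'⟩
  have hsum : ∀ s : Finset (Fin m), Φ (distOf (fun ω => ∑ k ∈ s, X (ω + k))) =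
      s.card * Φ (distOf X) := by
    intro s
    induction s using Finset.induction_on with
    | empty => simp [distOf_const hm, hconst]
    | insert a s ha ih =>
      simp only [Finset.sum_insert ha, Finset.card_insert_of_notMem ha]
      rw [hadd (fun ω => X (ω + a)) (fun ω => ∑ k ∈ s, X (ω + k)), ih,
        show distOf (fun ω => X (ω + a)) = distOf X from distOf_comp_equiv X (Equiv.addRight a)]
      push_cast
      ring
  have hshift : (fun ω => ∑ k, X (ω + k)) = fun _ : Fin m => ∑ ω, X ω :=
    funext fun ω => Equiv.sum_comp (Equiv.addLeft ω) X
  have h := hsum Finset.univ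
  rw [hshift, distOf_const hm, hconst, Finset.card_univ, Fintype.card_fin] at h
  exact h.symm

lemma IsDeltaQ.exists_rat {f : ℝ → ℝ} (hf : IsDeltaQ f) (x : ℝ) : ∃ q : ℚ, f x = q := by
  obtain ⟨⟨-, hfin, -⟩, hcdf⟩ := hf
  have hopen : (Function.support f \ {x})ᶜ ∈ 𝓝 x :=
    (hfin.subset Set.sdiff_subset).isClosed.isOpen_compl.mem_nhds (by simp)
  obtain ⟨ε, hε, hball⟩ := Metric.mem_nhds_iff.1 hopen
  obtain ⟨p, hp⟩ := hcdf x
  obtain ⟨q, hq⟩ := hcdf (x - ε / 2)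
  have hsupp (t : ℝ) : Function.support (fun y => if y ≤ t then f y else 0) ⊆
      hfin.toFinset := by
    intro y hy
    simp only [Function.mem_support, ne_eq, ite_eq_right_iff, not_forall] at hy
    simpa using hy.2
  refine ⟨p - q, ?_⟩
  push_cast
  rw [← hp, ← hq, cdfOf, cdfOf, finsum_eq_sum_of_support_subset _ (hsupp _),
    finsum_eq_sum_of_support_subset _ (hsupp _), ← Finset.sum_sub_distrib]
  rw [Finset.sum_eq_single x]
  · rw [if_pos le_rfl, if_neg (by linarith), sub_zero]
  · intro y hy hyx
    have hy' : y ∉ Metric.ball x ε := fun h => hball h ⟨by simpa using hy, hyx⟩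
    rw [Metric.mem_ball, Real.dist_eq, abs_lt, not_and_or, not_lt, not_lt] at hy'
    rcases hy' with h | h
    · rw [if_pos (by linarith), if_pos (by linarith), sub_self]
    · rw [if_neg (by linarith), if_neg (by linarith), sub_self]
  · intro hx
    have : f x = 0 := by simpa using hx
    simp [this]

/-- Every lottery in `Δ_ℚ` is realized by a random variable on a uniform finite space. -/
lemma IsDeltaQ.exists_realization {f : ℝ → ℝ} (hf : IsDeltaQ f) :
    ∃ m : ℕ, 0 < m ∧ ∃ X : Fin m → ℝ,
      ∀ g : ℝ → ℝ, ∑ ω, g (X ω) = m * ∑ᶠ x, g x * f x := by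
  choose q hq using hf.exists_rat
  obtain ⟨⟨hnn, hfin, hone⟩, -⟩ := hf
  set S := hfin.toFinset with hS
  set m := ∏ x ∈ S, (q x).den with hm
  have hmpos : 0 < m := Finset.prod_pos fun x _ => (q x).den_pos
  have hn : ∀ x : S, ∃ n : ℕ, (n : ℝ) = m * f x := by
    rintro ⟨x, hx⟩
    obtain ⟨k, hk⟩ : (q x).den ∣ m := Finset.dvd_prod_of_mem (fun x => (q x).den) hx
    have hq0 : 0 ≤ q x := by exact_mod_cast hq x ▸ hnn x
    obtain ⟨a, ha⟩ := Int.eq_ofNat_of_zero_le (Rat.num_nonneg.2 hq0)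
    refine ⟨k * a, ?_⟩
    have h : (q x).den * q x = a := by
      rw [Rat.den_mul_eq_num, ha]; rfl
    have h' : ((q x).den : ℝ) * (q x : ℝ) = a := by exact_mod_cast h
    rw [hk, hq x]
    push_cast
    rw [← h']
    ring
  choose n hn using hn
  have hsum (g : ℝ → ℝ) :
      ∑ p : (Σ x : S, Fin (n x)), g p.1 = m * ∑ᶠ x, g x * f x := by
    rw [finsum_eq_sum_of_support_subset (s := S) (fun x => g x * f x) (fun x hx => by
      simpa [hS] using right_ne_zero_of_mul hx), Finset.mul_sum, Fintype.sum_sigma,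
      ← Finset.sum_coe_sort S (fun x => (m : ℝ) * (g x * f x))]
    refine Finset.sum_congr rfl fun x _ => ?_
    simp only [Finset.sum_const, Finset.card_univ, Fintype.card_fin, nsmul_eq_mul, hn]
    ring
  have hcard : Fintype.card (Σ x : S, Fin (n x)) = m := by
    have h := hsum fun _ => 1
    simp only [Finset.sum_const, Finset.card_univ, one_mul, hone, nsmul_eq_mul, mul_one] at h
    exact_mod_cast h
  let e := (Fintype.equivFinOfCardEq hcard).symm
  exact ⟨m, hmpos, fun ω => (e ω).1, fun g =>
    (Equiv.sum_comp e fun p => g p.1).trans (hsum g)⟩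

/-- a monotone statistic on `Δ_ℚ` that is additive for all (not
necessarily independent) random variables on uniform finite probability spaces
is the expectation. -/
theorem stmt19 (Φ : (ℝ → ℝ) → ℝ)
    (hconst : ∀ c : ℝ, Φ (delta c) = c)
    (hmono : ∀ f g, IsDeltaQ f → IsDeltaQ g → FOSDgeF f g → Φ g ≤ Φ f)
    (hadd : ∀ m : ℕ, 0 < m → ∀ X Y : Fin m → ℝ,
      Φ (distOf (fun ω => X ω + Y ω)) = Φ (distOf X) + Φ (distOf Y)) :
    ∀ f, IsDeltaQ f → Φ f = expOf f := by
  intro f hf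
  obtain ⟨m, hm, X, hX⟩ := hf.exists_realization
  have hm' : (m : ℝ) ≠ 0 := by positivity
  have hdist : distOf X = f := by
    funext t
    have h : ∑ᶠ x, (if x = t then (1 : ℝ) else 0) * f x = f t := by
      rw [finsum_eq_single _ t fun x hx => by simp [hx]]
      simp
    rw [distOf, hX fun x => if x = t then 1 else 0, h, mul_div_cancel_left₀ _ hm']
  have h := additive_distOf Φ hconst hm (hadd m hm) X
  rw [hdist, hX fun x => x] at h
  exact mul_left_cancel₀ hm' h

end Paper
end
end
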